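/- Let α, β ∈ ℂ with β ≠ 0, and let s ∈ ℂ satisfy s² = 1 − 2α − 3α². Define φ = (−(1 + α) − s)/(2β) and ψ = (−(1 + α) + s)/(2β). Then φ·(1 + βφ) = α·ψ and ψ·(1 + βψ) = α·φ; in particular, if 1 + βφ ≠ 0 and 1 + βψ ≠ 0, then φ = αψ/(1 + βφ) and ψ = αφ/(1 + βψ), so that the 2-periodic sequence …, φ, ψ, φ, ψ, … (z_{2k} = φ, z_{2k+1} = ψ for all k) is a solution of the delay logistic difference equation. -/

import Mathlib

/-- The value `(-(1+α) - s)/(2β)` is mapped to its conjugate under `s ↦ -s`. -/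
theorem delay_logistic_root_mul (α β s : ℂ) (hβ : β ≠ 0)
    (hs : s ^ 2 = 1 - 2 * α - 3 * α ^ 2) :
    (-(1 + α) - s) / (2 * β) * (1 + β * ((-(1 + α) - s) / (2 * β))) =
      α * ((-(1 + α) + s) / (2 * β)) := by
  field_simp
  linear_combination hs

/-- With `β ≠ 0` and `s² = 1 - 2α - 3α²`, the values
`φ = (-(1+α) - s)/(2β)` and `ψ = (-(1+α) + s)/(2β)` satisfy `φ(1+βφ) = αψ` and
`ψ(1+βψ) = αφ`; in particular, if both denominators are nonzero then
`φ = αψ/(1+βφ)` and `ψ = αφ/(1+βψ)`, so the 2-periodic sequence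
`…, φ, ψ, φ, ψ, …` is a solution of the delay logistic equation
`z_{n+1} = α z_n / (1 + β z_{n-1})`. -/
theorem delay_logistic_period_two_formula (α β s : ℂ) (hβ : β ≠ 0)
    (hs : s ^ 2 = 1 - 2 * α - 3 * α ^ 2) :
    ∀ φ ψ : ℂ, φ = (-(1 + α) - s) / (2 * β) → ψ = (-(1 + α) + s) / (2 * β) →
      φ * (1 + β * φ) = α * ψ ∧ ψ * (1 + β * ψ) = α * φ ∧
      (1 + β * φ ≠ 0 → 1 + β * ψ ≠ 0 →
        φ = α * ψ / (1 + β * φ) ∧ ψ = α * φ / (1 + β * ψ) ∧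
        ∀ z : ℕ → ℂ, (∀ k, z (2 * k) = φ) → (∀ k, z (2 * k + 1) = ψ) →
          ∀ n, z (n + 2) = α * z (n + 1) / (1 + β * z n)) := by
  rintro φ ψ rfl rfl
  have hφ := delay_logistic_root_mul α β s hβ hs
  have hψ := delay_logistic_root_mul α β (-s) hβ (by rw [neg_sq, hs])
  rw [sub_neg_eq_add, ← sub_eq_add_neg] at hψ
  refine ⟨hφ, hψ, fun h₁ h₂ => ?_⟩
  have hφ' := eq_div_of_mul_eq h₁ hφ
  have hψ' := eq_div_of_mul_eq h₂ hψ
  refine ⟨hφ', hψ', fun z he ho n => ?_⟩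
  obtain ⟨k, rfl | rfl⟩ := n.even_or_odd'
  · rw [show 2 * k + 2 = 2 * (k + 1) by ring, he, ho, he]
    exact hφ'
  · rw [show 2 * k + 1 + 2 = 2 * (k + 1) + 1 by ring,
      show 2 * k + 1 + 1 = 2 * (k + 1) by ring, ho, he, ho]
    exact hψ'
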